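/- arXiv:2505.09911 — 2 statements merged into one kernel-verified Lean document; each statement's English description precedes it below -/
import Mathlib

section
/- Let [a,b] ⊂ ℝ be a compact interval, let σ : ℝ → ℝ be the sigmoid function σ(x) = 1/(1 + exp(-x)), and let f : [a,b] → ℝ be continuously differentiable. Then for every ε > 0 there exist n ∈ ℕ and parameters c_1,...,c_n, w_1,...,w_n, b_1,...,b_n ∈ ℝ such that the single-hidden-layer network g(x) = Σ_{j=1}^n c_j σ(w_j x + b_j) satisfies sup_{x ∈ [a,b]} |f(x) − g(x)| < ε and sup_{x ∈ [a,b]} |f'(x) − g'(x)| < ε. -/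
open Set

/-- Every real polynomial has a polynomial antiderivative. -/
theorem exists_derivative_eq (p : Polynomial ℝ) :
    ∃ q : Polynomial ℝ, Polynomial.derivative q = p := by
  induction p using Polynomial.induction_on' with
  | add p q hp hq =>
    obtain ⟨r, rfl⟩ := hp
    obtain ⟨s, rfl⟩ := hq
    exact ⟨r + s, Polynomial.derivative_add⟩
  | monomial n c =>
    refine ⟨Polynomial.monomial (n + 1) (c / (n + 1)), ?_⟩
    rw [Polynomial.derivative_monomial]
    have : (n : ℝ) + 1 ≠ 0 := by positivity
    push_cast
    rw [div_mul_cancel₀ _ this]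

/-- A `C¹` function on a nondegenerate compact interval is approximated, together with its
derivative, by polynomials in `exp`. -/
theorem exists_polynomial_exp_near {a b : ℝ} (hab : a < b) {f : ℝ → ℝ}
    (hf : ContDiffOn ℝ 1 f (Icc a b)) {ε : ℝ} (hε : 0 < ε) :
    ∃ q : Polynomial ℝ, ∀ x ∈ Icc a b,
      |f x - q.eval (Real.exp x)| < ε ∧
      |derivWithin f (Icc a b) x
        - (Polynomial.derivative q).eval (Real.exp x) * Real.exp x| < ε := by
  have hcont : ContinuousOn (derivWithin f (Icc a b)) (Icc a b) :=
    hf.continuousOn_derivWithin (uniqueDiffOn_Icc hab) le_rfl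
  have hpos : ∀ y ∈ Icc (Real.exp a) (Real.exp b), 0 < y :=
    fun y hy => (Real.exp_pos a).trans_le hy.1
  have hh : ContinuousOn (fun y => derivWithin f (Icc a b) (Real.log y) / y)
      (Icc (Real.exp a) (Real.exp b)) := by
    refine ContinuousOn.div (hcont.comp (Real.continuousOn_log.mono ?_) ?_) continuousOn_id
      fun y hy => (hpos y hy).ne'
    · exact fun y hy => (hpos y hy).ne'
    · exact fun y hy => ⟨(Real.le_log_iff_exp_le (hpos y hy)).2 hy.1,
        (Real.log_le_iff_le_exp (hpos y hy)).2 hy.2⟩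
  have hba : 0 < b - a := sub_pos.2 hab
  set δ := ε / (1 + (b - a)) with hδ
  have hδ0 : 0 < δ := by positivity
  have hδε : δ * (1 + (b - a)) = ε := div_mul_cancel₀ _ (by positivity)
  obtain ⟨p, hp⟩ := exists_polynomial_near_of_continuousOn _ _ _ hh (δ / Real.exp b)
    (by positivity)
  obtain ⟨q, rfl⟩ := exists_derivative_eq p
  have hder : ∀ x ∈ Icc a b, |derivWithin f (Icc a b) x
      - (Polynomial.derivative q).eval (Real.exp x) * Real.exp x| < δ := by
    intro x hx
    have h := hp (Real.exp x) ⟨Real.exp_le_exp.2 hx.1, Real.exp_le_exp.2 hx.2⟩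
    rw [Real.log_exp, abs_sub_comm, lt_div_iff₀ (Real.exp_pos b)] at h
    refine lt_of_le_of_lt ?_ h
    have hx0 := Real.exp_pos x
    calc _ = |derivWithin f (Icc a b) x / Real.exp x
            - (Polynomial.derivative q).eval (Real.exp x)| * Real.exp x := by
          rw [← abs_of_pos hx0, ← abs_mul, abs_of_pos hx0, sub_mul, div_mul_cancel₀ _ hx0.ne']
      _ ≤ _ := by gcongr; exact hx.2
  refine ⟨q + Polynomial.C (f a - q.eval (Real.exp a)), fun x hx => ⟨?_, ?_⟩⟩
  · have ha : a ∈ Icc a b := left_mem_Icc.2 hab.le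
    have hmv := Convex.norm_image_sub_le_of_norm_hasDerivWithin_le
      (f := fun x => f x - q.eval (Real.exp x))
      (fun x hx => ((hf.differentiableOn one_ne_zero x hx).hasDerivWithinAt).sub
        ((q.hasDerivAt (Real.exp x)).comp x (Real.hasDerivAt_exp x)).hasDerivWithinAt)
      (fun x hx => (hder x hx).le) (convex_Icc a b) ha hx
    rw [Real.norm_eq_abs, Real.norm_eq_abs, abs_of_nonneg (sub_nonneg.2 hx.1)] at hmv
    have hrw : f x - (q + Polynomial.C (f a - q.eval (Real.exp a))).eval (Real.exp x)
        = f x - q.eval (Real.exp x) - (f a - q.eval (Real.exp a)) := by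
      simp only [Polynomial.eval_add, Polynomial.eval_C]; ring
    rw [hrw]
    have := mul_le_mul_of_nonneg_left (sub_le_sub_right hx.2 a) hδ0.le
    linarith
  · have := mul_pos hδ0 hba
    simpa using (hder x hx).trans (by linarith)

/-- Rescaled translates of the sigmoid are Möbius perturbations of the exponential. -/
theorem sigmoid_shift_eq {σ : ℝ → ℝ} (hσ : ∀ t, σ t = 1 / (1 + Real.exp (-t)))
    {η : ℝ} (hη : 0 < η) (t : ℝ) :
    η⁻¹ * σ (t + Real.log η) = Real.exp t / (1 + η * Real.exp t) := by
  have := Real.exp_pos t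
  rw [hσ, neg_add, Real.exp_add, Real.exp_neg, Real.exp_neg, Real.exp_log hη]
  field_simp
  ring

theorem hasDerivAt_mobius_exp {η : ℝ} (hη : 0 < η) (k x : ℝ) :
    HasDerivAt (fun y => Real.exp (k * y) / (1 + η * Real.exp (k * y)))
      (k * Real.exp (k * x) / (1 + η * Real.exp (k * x)) ^ 2) x := by
  have he : HasDerivAt (fun y => Real.exp (k * y)) (Real.exp (k * x) * k) x := by
    simpa using ((hasDerivAt_id x).const_mul k).exp
  have hne : 1 + η * Real.exp (k * x) ≠ 0 := by positivity
  refine (he.fun_div ((he.const_mul η).const_add 1) hne).congr_deriv ?_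
  ring

theorem abs_sub_mobius_le {η u : ℝ} (hη : 0 < η) (hu : 0 < u) :
    |u - u / (1 + η * u)| ≤ η * (2 * u ^ 2) := by
  have h : u - u / (1 + η * u) = η * u ^ 2 / (1 + η * u) := by field_simp; ring
  have : 0 < η * u := by positivity
  rw [h, abs_of_pos (by positivity), div_le_iff₀ (by positivity)]
  have : 0 < η * u ^ 2 := by positivity
  nlinarith

theorem abs_sub_mobius_sq_le {η u : ℝ} (hη : 0 < η) (hu : 0 < u) :
    |u - u / (1 + η * u) ^ 2| ≤ η * (2 * u ^ 2) := by
  have h : u - u / (1 + η * u) ^ 2 = η * u ^ 2 * (2 + η * u) / (1 + η * u) ^ 2 := by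
    field_simp; ring
  have h1 : 0 < η * u := by positivity
  rw [h, abs_of_pos (by positivity), div_le_iff₀ (by positivity)]
  have h2 : 0 < η * u ^ 2 := by positivity
  nlinarith [mul_pos h1 h2, mul_pos h1 (mul_pos h1 h2)]

/-- Polynomials in `exp` are approximated, together with their derivatives, by sigmoid networks. -/
theorem exists_network_near_polynomial_exp {σ : ℝ → ℝ}
    (hσ : ∀ t, σ t = 1 / (1 + Real.exp (-t))) (q : Polynomial ℝ) (b : ℝ) {ε : ℝ} (hε : 0 < ε) :
    ∃ (n : ℕ) (c w β : Fin n → ℝ), ∀ x ≤ b,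
      |q.eval (Real.exp x) - ∑ j, c j * σ (w j * x + β j)| < ε ∧
      |(Polynomial.derivative q).eval (Real.exp x) * Real.exp x
        - deriv (fun y : ℝ => ∑ j, c j * σ (w j * y + β j)) x| < ε := by
  set n := q.natDegree + 1
  set K : ℝ := ∑ j : Fin n, |q.coeff j| * ((1 + (j : ℝ)) * (2 * Real.exp ((j : ℝ) * b) ^ 2))
  have hK : 0 ≤ K := by positivity
  set η : ℝ := ε / (K + 1)
  have hη : 0 < η := by positivity
  have hKε : η * K < ε := by
    have : η * (K + 1) = ε := div_mul_cancel₀ _ (by positivity)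
    linarith
  refine ⟨n, fun j => q.coeff j * η⁻¹, fun j => j, fun _ => Real.log η, fun x hx => ?_⟩
  have hnet : (fun y : ℝ => ∑ j : Fin n, q.coeff j * η⁻¹ * σ ((j : ℝ) * y + Real.log η)) =
      fun y => ∑ j : Fin n, q.coeff j *
        (Real.exp ((j : ℝ) * y) / (1 + η * Real.exp ((j : ℝ) * y))) := by
    funext y
    simp only [mul_assoc, sigmoid_shift_eq hσ hη]
  have hpoly : (fun y => q.eval (Real.exp y)) =
      fun y => ∑ j : Fin n, q.coeff j * Real.exp ((j : ℝ) * y) := by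
    funext y
    rw [Polynomial.eval_eq_sum_range, Finset.sum_range]
    simp only [Real.exp_nat_mul, n]
  have hpoly_deriv : (Polynomial.derivative q).eval (Real.exp x) * Real.exp x =
      ∑ j : Fin n, q.coeff j * ((j : ℝ) * Real.exp ((j : ℝ) * x)) := by
    refine ((q.hasDerivAt (Real.exp x)).comp x (Real.hasDerivAt_exp x)).unique ?_
    change HasDerivAt (fun y => q.eval (Real.exp y)) _ x
    rw [hpoly]
    refine HasDerivAt.fun_sum fun j _ => HasDerivAt.const_mul _ ?_
    simpa [mul_comm] using ((hasDerivAt_id x).const_mul (j : ℝ)).exp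
  have hnet_deriv := (HasDerivAt.fun_sum fun (j : Fin n) (_ : j ∈ Finset.univ) =>
    (hasDerivAt_mobius_exp hη (j : ℝ) x).const_mul (q.coeff j)).deriv
  have hsum : ∀ u v : Fin n → ℝ,
      (∀ j : Fin n, |u j - v j| ≤ (1 + (j : ℝ)) * (η * (2 * Real.exp ((j : ℝ) * x) ^ 2))) →
      |∑ j : Fin n, q.coeff j * u j - ∑ j : Fin n, q.coeff j * v j| < ε := by
    intro u v huv
    refine lt_of_le_of_lt ?_ hKε
    rw [← Finset.sum_sub_distrib, Finset.mul_sum]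
    refine (Finset.abs_sum_le_sum_abs _ _).trans (Finset.sum_le_sum fun j _ => ?_)
    rw [← mul_sub, abs_mul]
    calc _ ≤ |q.coeff j| * ((1 + (j : ℝ)) * (η * (2 * Real.exp ((j : ℝ) * b) ^ 2))) := by
          gcongr
          refine (huv j).trans ?_
          gcongr
      _ = _ := by ring
  constructor
  · rw [congrFun hpoly x, congrFun hnet x]
    refine hsum _ _ fun j => (abs_sub_mobius_le hη (Real.exp_pos _)).trans ?_
    exact le_mul_of_one_le_left (by positivity) (by simp)
  · rw [hpoly_deriv, hnet, hnet_deriv]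
    refine hsum _ _ fun j => ?_
    rw [mul_div_assoc, ← mul_sub, abs_mul, Nat.abs_cast]
    exact mul_le_mul (by simp) (abs_sub_mobius_sq_le hη (Real.exp_pos _))
      (abs_nonneg _) (by positivity)

/-- Simultaneous uniform approximation of a `C¹` function and its derivative on a
compact interval by a single-hidden-layer sigmoid network. -/
theorem stmt1
    (a b : ℝ) (hab : a ≤ b)
    (σ : ℝ → ℝ) (hσ : ∀ t, σ t = 1 / (1 + Real.exp (-t)))
    (f : ℝ → ℝ) (hf : ContDiffOn ℝ 1 f (Icc a b))
    (ε : ℝ) (hε : 0 < ε) :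
    ∃ (n : ℕ) (c w β : Fin n → ℝ),
      ∀ x ∈ Icc a b,
        |f x - ∑ j, c j * σ (w j * x + β j)| < ε ∧
        |derivWithin f (Icc a b) x
          - deriv (fun y : ℝ => ∑ j, c j * σ (w j * y + β j)) x| < ε := by
  rcases hab.eq_or_lt with rfl | hlt
  · refine ⟨1, fun _ => 2 * f a, fun _ => 0, fun _ => 0, fun x hx => ?_⟩
    obtain rfl : x = a := by simpa using hx
    have hσ0 : 2 * f x * σ 0 = f x := by
      rw [hσ, neg_zero, Real.exp_zero]
      ring
    have hacc : ¬ UniqueDiffWithinAt ℝ {x} x := by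
      rw [uniqueDiffWithinAt_iff_accPt]
      exact fun h => Set.Infinite.of_accPt h (finite_singleton x)
    simp [hσ0, hε, derivWithin_zero_of_not_uniqueDiffWithinAt hacc]
  · obtain ⟨q, hq⟩ := exists_polynomial_exp_near hlt hf (half_pos hε)
    obtain ⟨n, c, w, β, hnet⟩ := exists_network_near_polynomial_exp hσ q b (half_pos hε)
    refine ⟨n, c, w, β, fun x hx => ⟨?_, ?_⟩⟩
    · exact (abs_sub_le _ _ _).trans_lt
        ((add_lt_add (hq x hx).1 (hnet x hx.2).1).trans_eq (add_halves ε))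
    · exact (abs_sub_le _ _ _).trans_lt
        ((add_lt_add (hq x hx).2 (hnet x hx.2).2).trans_eq (add_halves ε))
end

section
/- Let σ : ℝ → ℝ be continuous, let n ∈ ℕ, C > 0 and 1 ≤ p < ∞. Then the set of equivalence classes in L^p([0,1], ℂ) (with Lebesgue measure) of the functions { x ↦ Σ_{j=1}^n c_j σ(w_j x + b_j) : w, b ∈ ℝ^n, c ∈ ℂ^n, max_j |w_j| ≤ C, max_j |b_j| ≤ C, max_j |c_j| ≤ C } is a compact subset of L^p([0,1], ℂ). In particular it is closed in L^p([0,1], ℂ). -/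
open MeasureTheory
open scoped ENNReal

/-- A compact family of functions depending jointly continuously on a parameter and a variable in
a compact interval gives a compact subset of `L^p` of that interval. -/
theorem isCompact_setOf_ae_eq_continuous_family {X E : Type*} [TopologicalSpace X]
    [NormedAddCommGroup E] [NormedSpace ℝ E]
    {p : ℝ≥0∞} [Fact (1 ≤ p)] {a b : ℝ} (hab : a ≤ b) {f : X → ℝ → E}
    (hf : Continuous (Function.uncurry f)) {K : Set X} (hK : IsCompact K) :
    IsCompact {F : Lp E p (volume.restrict (Set.Icc a b)) |
      ∃ x ∈ K, ∀ᵐ t ∂(volume.restrict (Set.Icc a b)), F t = f x t} := by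
  let g : C(X, C(Set.Icc a b, E)) :=
    ContinuousMap.curry ⟨fun q => f q.1 q.2,
      hf.comp (continuous_fst.prodMk (continuous_subtype_val.comp continuous_snd))⟩
  let π : C(ℝ, Set.Icc a b) := ⟨Set.projIcc a b hab, continuous_projIcc⟩
  let T : X → BoundedContinuousFunction ℝ E := fun x =>
    (BoundedContinuousFunction.mkOfCompact (g x)).compContinuous π
  have hT : Continuous T :=
    (BoundedContinuousFunction.continuous_compContinuous π).comp
      ((ContinuousMap.isometryEquivBoundedOfCompact (Set.Icc a b) E).continuous.comp g.continuous)
  let L : X → Lp E p (volume.restrict (Set.Icc a b)) := fun x =>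
    BoundedContinuousFunction.toLp p (volume.restrict (Set.Icc a b)) ℝ (T x)
  have hL : Continuous L := (ContinuousLinearMap.continuous _).comp hT
  have hL_ae (x : X) : ∀ᵐ t ∂(volume.restrict (Set.Icc a b)), L x t = f x t := by
    filter_upwards [BoundedContinuousFunction.coeFn_toLp (𝕜 := ℝ) p
      (volume.restrict (Set.Icc a b)) (T x), ae_restrict_mem measurableSet_Icc] with t ht htI
    refine ht.trans ?_
    change f x (Set.projIcc a b hab t) = f x t
    rw [Set.projIcc_of_mem hab htI]
  convert hK.image hL using 1
  ext F
  constructor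
  · rintro ⟨x, hx, hF⟩
    refine ⟨x, hx, Lp.ext ?_⟩
    filter_upwards [hF, hL_ae x] with t h₁ h₂
    rw [h₁, h₂]
  · rintro ⟨x, hx, rfl⟩
    exact ⟨x, hx, hL_ae x⟩

/-- The class of (equivalence classes in `L^p([0,1],ℂ)` of) single-hidden-layer networks
with parameters bounded by `C` is a compact (in particular closed) subset of `L^p`. -/
theorem stmt4
    (σ : ℝ → ℝ) (hσ : Continuous σ) (n : ℕ) (C : ℝ) (hC : 0 < C)
    (p : ℝ≥0∞) [Fact (1 ≤ p)] (hp : p ≠ ⊤) :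
    IsCompact {F : Lp ℂ p (volume.restrict (Set.Icc (0 : ℝ) 1)) |
        ∃ (w b : Fin n → ℝ) (c : Fin n → ℂ),
          (∀ j, |w j| ≤ C) ∧ (∀ j, |b j| ≤ C) ∧ (∀ j, ‖c j‖ ≤ C) ∧
          ∀ᵐ x ∂(volume.restrict (Set.Icc (0 : ℝ) 1)),
            F x = ∑ j, c j * (σ (w j * x + b j) : ℂ)} ∧
    IsClosed {F : Lp ℂ p (volume.restrict (Set.Icc (0 : ℝ) 1)) |
        ∃ (w b : Fin n → ℝ) (c : Fin n → ℂ),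
          (∀ j, |w j| ≤ C) ∧ (∀ j, |b j| ≤ C) ∧ (∀ j, ‖c j‖ ≤ C) ∧
          ∀ᵐ x ∂(volume.restrict (Set.Icc (0 : ℝ) 1)),
            F x = ∑ j, c j * (σ (w j * x + b j) : ℂ)} := by
  refine (fun h => And.intro h h.isClosed) ?_
  let K : Set ((Fin n → ℝ) × (Fin n → ℝ) × (Fin n → ℂ)) :=
    (Set.univ.pi fun _ => Metric.closedBall 0 C) ×ˢ
      (Set.univ.pi fun _ => Metric.closedBall 0 C) ×ˢ
        (Set.univ.pi fun _ => Metric.closedBall 0 C)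
  have hK : IsCompact K :=
    (isCompact_univ_pi fun _ => isCompact_closedBall 0 C).prod
      ((isCompact_univ_pi fun _ => isCompact_closedBall 0 C).prod
        (isCompact_univ_pi fun _ => isCompact_closedBall 0 C))
  have hf : Continuous (Function.uncurry
      fun (θ : (Fin n → ℝ) × (Fin n → ℝ) × (Fin n → ℂ)) (x : ℝ) =>
        ∑ j, θ.2.2 j * (σ (θ.1 j * x + θ.2.1 j) : ℂ)) := by
    unfold Function.uncurry
    fun_prop
  convert isCompact_setOf_ae_eq_continuous_family (p := p) zero_le_one hf hK using 1
  ext F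
  simp [K, Set.mem_pi, and_assoc]
end
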